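/- For every n ≥ 1 there exists a rooted binary tree T with n leaves such that S(T) = −2^k + n(k+1), where k = ⌈log₂ n⌉; hence the lower bound −2^k + n(k+1) for the Sackin index is tight. -/

import Mathlib

/-- Rooted binary trees: a single node (leaf) or a root with two subtrees. -/
inductive BTree : Type
  | leaf : BTree
  | node : BTree → BTree → BTree

namespace BTree

/-- Number of leaves of a rooted binary tree. -/
def leaves : BTree → ℕ
  | leaf => 1
  | node l r => l.leaves + r.leaves

/-- Sum of depths of all leaves, where the root of the tree is at depth `d`. -/
def sackinAux : BTree → ℕ → ℕ
  | leaf, d => d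
  | node l r, d => sackinAux l (d + 1) + sackinAux r (d + 1)

/-- Sackin index: the sum of the depths of all leaves. -/
def sackin (t : BTree) : ℕ := sackinAux t 0

/-- Sum, over all internal nodes `u`, of the number of leaves below `u`. -/
def internalLeafSum : BTree → ℕ
  | leaf => 0
  | node l r => (l.leaves + r.leaves) + internalLeafSum l + internalLeafSum r

/-- Sum, over all nodes `v`, of the number of leaves below `v`. -/
def allNodesLeafSum : BTree → ℕ
  | leaf => 1
  | node l r => (l.leaves + r.leaves) + allNodesLeafSum l + allNodesLeafSum r

/-- Sum, over all non-root nodes `v`, of the number of leaves below `v`. -/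
def nonRootLeafSum : BTree → ℕ
  | leaf => 0
  | node l r => allNodesLeafSum l + allNodesLeafSum r

/-- Height: maximal number of edges on a root-to-leaf path. -/
def height : BTree → ℕ
  | leaf => 0
  | node l r => max l.height r.height + 1

/-- Subtree at a given path from the root (`false` = left child, `true` = right child). -/
def subtreeAt : BTree → List Bool → Option BTree
  | t, [] => some t
  | leaf, _ :: _ => none
  | node l _, false :: p => subtreeAt l p
  | node _ r, true :: p => subtreeAt r p

/-- Number of cherries (pairs of sibling leaves) whose two leaves are at depth `d`. -/
def cherriesAt : BTree → ℕ → ℕ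
  | leaf, _ => 0
  | node leaf leaf, d => if d = 1 then 1 else 0
  | node _ _, 0 => 0
  | node l r, d + 1 => cherriesAt l d + cherriesAt r d

/-- `DeleteCherry t d t'` : `t'` is obtained from `t` by deleting a cherry `[u,v]`
(both leaves at depth `d`) together with the two pendant edges, turning the
parent `w` into a leaf. -/
inductive DeleteCherry : BTree → ℕ → BTree → Prop
  | base : DeleteCherry (BTree.node BTree.leaf BTree.leaf) 1 BTree.leaf
  | left {l l' r : BTree} {d : ℕ} :
      DeleteCherry l d l' → DeleteCherry (BTree.node l r) (d + 1) (BTree.node l' r)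
  | right {l r r' : BTree} {d : ℕ} :
      DeleteCherry r d r' → DeleteCherry (BTree.node l r) (d + 1) (BTree.node l r')

/-- Caterpillar tree with `n` leaves (for `n ≥ 1`): the unique rooted binary tree
with exactly one cherry. -/
def caterpillar : ℕ → BTree
  | 0 => BTree.leaf
  | 1 => BTree.leaf
  | n + 2 => BTree.node (caterpillar (n + 1)) BTree.leaf

/-- Fully balanced tree of height `k`, with `2^k` leaves all at depth `k`. -/
def balanced : ℕ → BTree
  | 0 => BTree.leaf
  | k + 1 => BTree.node (balanced k) (balanced k)

/-- Isomorphism of rooted binary trees (children are unordered). -/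
inductive Iso : BTree → BTree → Prop
  | leaf : Iso BTree.leaf BTree.leaf
  | node {a b c d : BTree} : Iso a c → Iso b d → Iso (BTree.node a b) (BTree.node c d)
  | swap {a b c d : BTree} : Iso a d → Iso b c → Iso (BTree.node a b) (BTree.node c d)

end BTree

open BTree

theorem exists_tree_aux (k : ℕ) : ∀ n : ℕ, 2 ^ k ≤ n → n ≤ 2 ^ (k + 1) →
    ∃ t : BTree, t.leaves = n ∧ ∀ d, t.sackinAux d + 2 ^ (k + 1) = n * (k + 2 + d) := by
  induction k with
  | zero =>
    intro n h1 h2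
    have h : n = 1 ∨ n = 2 := by
      norm_num at h1 h2
      omega
    rcases h with rfl | rfl
    · exact ⟨BTree.leaf, rfl, fun d => by simp only [sackinAux]; omega⟩
    · exact ⟨BTree.node BTree.leaf BTree.leaf, rfl, fun d => by simp only [sackinAux]; omega⟩
  | succ k ih =>
    intro n h1 h2
    have e1 : 2 ^ (k + 1) = 2 * 2 ^ k := by ring
    have e2 : 2 ^ (k + 1 + 1) = 2 * 2 ^ (k + 1) := by ring
    obtain ⟨l, hl, hl'⟩ := ih (n / 2) (by omega) (by omega)
    obtain ⟨r, hr, hr'⟩ := ih (n - n / 2) (by omega) (by omega)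
    refine ⟨BTree.node l r, by simp only [leaves]; omega, fun d => ?_⟩
    have a := hl' (d + 1)
    have b := hr' (d + 1)
    have c : n / 2 + (n - n / 2) = n := by omega
    simp only [sackinAux]
    calc _ = (n / 2 + (n - n / 2)) * (k + 2 + (d + 1)) := by
          rw [add_mul, ← a, ← b, e2]; ring
      _ = _ := by rw [c]; ring

/-- for every `n ≥ 1` there is a rooted binary tree with `n`
leaves attaining `S(T) = −2^k + n(k+1)` for `k = ⌈log₂ n⌉` (stated additively),
so the lower bound is tight. -/
theorem stmt12 (n : ℕ) (hn : 1 ≤ n) :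
    ∃ t : BTree, t.leaves = n ∧
      t.sackin + 2 ^ Nat.clog 2 n = n * (Nat.clog 2 n + 1) := by 
  rcases Nat.lt_or_ge 1 n with h | h
  · have hpos : 0 < Nat.clog 2 n := Nat.clog_pos (by norm_num) h
    obtain ⟨k, hk⟩ : ∃ k, Nat.clog 2 n = k + 1 := ⟨Nat.clog 2 n - 1, by omega⟩
    have h1 : n ≤ 2 ^ Nat.clog 2 n := Nat.le_pow_clog (by norm_num) n
    have h2 : 2 ^ (Nat.clog 2 n).pred < n := Nat.pow_pred_clog_lt_self (by norm_num) h
    rw [hk] at h1 h2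
    obtain ⟨t, ht, ht'⟩ := exists_tree_aux k n (by simpa using h2.le) h1
    exact ⟨t, ht, by rw [hk]; exact ht' 0⟩
  · obtain rfl : n = 1 := by omega
    exact ⟨BTree.leaf, rfl, by simp [sackin, sackinAux]⟩
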